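/- arXiv:2209.01119 — 3 statements merged into one kernel-verified Lean document; each statement's English description precedes it below -/
import Mathlib

section
/- Let Ξ be a countable type, p a probability mass function on Ξ, g : ℝⁿ → Ξ → ℝᵐ a constraint map, x ∈ ℝⁿ fixed, and set M = {ξ ∈ Ξ | ∀ i, g(x, ξ)_i ≤ 0}. Let α > 0 and β ∈ ℝ be such that ∑_{ξ : p(ξ) ≥ α} p(ξ) = 1 − β. If ∑_{ξ ∈ M} p(ξ) ≥ 1 − β and p(a) ≥ p(b) for every a ∈ M and every b ∉ M, then {ξ ∈ Ξ | p(ξ) ≥ α} ⊆ M; that is, x is feasible for the probability contour constraint with threshold α. -/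
open scoped ENNReal

/-- Proposition 2.2, part 2 (discrete form): if every outcome satisfied by a
chance-constraint-feasible point `x` has probability at least as large as every
outcome violated by `x`, then `x` is feasible for the probability contour
constraint with threshold `α`. -/
theorem cc_feasible_implies_pcc_feasible {n m : ℕ} {Ξ : Type*} [Countable Ξ]
    (p : PMF Ξ) (g : (Fin n → ℝ) → Ξ → Fin m → ℝ) (x : Fin n → ℝ)
    (M : Set Ξ) (hM : M = {ξ | ∀ i, g x ξ i ≤ 0})
    (α β : ℝ) (hα : 0 < α)
    (hcontour : ∑' ξ : {ξ : Ξ | p ξ ≥ ENNReal.ofReal α}, p ξ = ENNReal.ofReal (1 - β))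
    (hfeas : ∑' ξ : M, p ξ ≥ ENNReal.ofReal (1 - β))
    (hcomp : ∀ a ∈ M, ∀ b ∉ M, p a ≥ p b) :
    {ξ : Ξ | p ξ ≥ ENNReal.ofReal α} ⊆ M := by
  intro b hb
  by_contra hbM
  have hsub : insert b M ⊆ {ξ : Ξ | p ξ ≥ ENNReal.ofReal α} :=
    Set.insert_subset hb fun a ha => le_trans hb (hcomp a ha b hbM)
  have hinsert : ∑' ξ : ↑(insert b M), p ξ = p b + ∑' ξ : M, p ξ := by
    rw [Set.insert_eq, ENNReal.summable.tsum_union_disjoint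
      (Set.disjoint_singleton_left.2 hbM) ENNReal.summable, tsum_singleton]
  have hle : p b + ∑' ξ : M, p ξ ≤ ∑' ξ : M, p ξ := by
    rw [← hinsert]
    exact (ENNReal.tsum_mono_subtype p hsub).trans (hcontour.trans_le hfeas)
  have hfin : ∑' ξ : M, p ξ ≠ ∞ :=
    ne_top_of_le_ne_top p.tsum_coe_ne_top (ENNReal.tsum_comp_le_tsum_of_injective
      Subtype.val_injective p)
  have hpos : 0 < p b := (ENNReal.ofReal_pos.2 hα).trans_le hb
  exact (ENNReal.lt_add_right hfin hpos.ne').not_ge (add_comm (p b) _ ▸ hle)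
end

section
/- Let U be a finite set with |U| = D, let z ≤ D, let m ∈ ℕ, and let A₁, …, A_B ⊆ U be pairwise disjoint subsets with |A_i| ≥ m for every i. Then the number of z-element subsets S of U satisfying S ∩ A_i ≠ ∅ for every i = 1, …, B is at least C(D, z) + ∑_{k=1}^{B} (−1)^k C(B, k) · C(D − k·m, z), where the inequality is understood in the integers and C(·,·) denotes the binomial coefficient (with C(a, z) = 0 when a < z). -/
open Finset in
/-- Inclusion-exclusion count of the `z`-element subsets meeting each of finitely many pairwise
disjoint sets of the same size `m`. -/
theorem card_powersetCard_filter_inter_nonempty {U ι : Type*} [Fintype U] [DecidableEq U]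
    [Fintype ι] (z m : ℕ) (A : ι → Finset U)
    (hdisj : Pairwise fun i j => Disjoint (A i) (A j)) (hcard : ∀ i, (A i).card = m) :
    ((((univ : Finset U).powersetCard z).filter fun S => ∀ i, (S ∩ A i).Nonempty).card : ℤ) =
      ∑ k ∈ range (Fintype.card ι + 1), (-1 : ℤ) ^ k * ((Fintype.card ι).choose k : ℤ) *
        ((Fintype.card U - k * m).choose z : ℤ) := by
  classical
  have avoid (t : Finset ι) :
      (((univ : Finset U).powersetCard z).filter fun S => ∀ i ∈ t, ¬ (S ∩ A i).Nonempty).card =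
        (Fintype.card U - t.card * m).choose z := by
    have h : (((univ : Finset U).powersetCard z).filter
        fun S => ∀ i ∈ t, ¬ (S ∩ A i).Nonempty) = ((t.biUnion A)ᶜ).powersetCard z := by
      ext S
      simp only [mem_filter, mem_powersetCard, subset_univ, true_and,
        not_nonempty_iff_eq_empty, ← disjoint_iff_inter_eq_empty, subset_compl_iff_disjoint_right,
        disjoint_biUnion_right, and_comm]
    rw [h, card_powersetCard, card_compl, card_biUnion fun i _ j _ hij => hdisj hij,
      sum_const_nat fun i _ => hcard i]
  have indicator (S : Finset U) :
      (if ∀ i, (S ∩ A i).Nonempty then (1 : ℤ) else 0) =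
        ∑ t : Finset ι, (-1 : ℤ) ^ t.card *
          if ∀ i ∈ t, ¬ (S ∩ A i).Nonempty then 1 else 0 := by
    have h := prod_one_add (f := fun i => -(if ¬ (S ∩ A i).Nonempty then (1 : ℤ) else 0)) univ
    simp only [prod_neg, prod_boole, powerset_univ] at h
    rw [← Fintype.prod_boole]
    trans
    swap
    · convert h
    refine prod_congr rfl fun i _ => ?_
    split_ifs <;> simp
  rw [card_filter, Nat.cast_sum]
  simp only [Nat.cast_ite, Nat.cast_one, Nat.cast_zero, indicator]
  rw [sum_comm, ← powerset_univ]
  simp only [← mul_sum, sum_boole, avoid]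
  rw [sum_powerset_apply_card (fun k => (-1 : ℤ) ^ k * ((Fintype.card U - k * m).choose z : ℤ)),
    card_univ]
  refine sum_congr rfl fun k _ => ?_
  rw [nsmul_eq_mul]
  ring

/-- Theorem 3.1 (combinatorial content): an inclusion–exclusion lower bound on the number
of `z`-element subsets meeting each of `B` pairwise disjoint groups, each of size `≥ m`. -/
theorem card_subsets_meeting_all_groups_ge {U : Type*} [Fintype U] [DecidableEq U]
    (D z m B : ℕ) (hD : Fintype.card U = D) (hz : z ≤ D)
    (A : Fin B → Finset U)
    (hdisj : Pairwise fun i j => Disjoint (A i) (A j))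
    (hcard : ∀ i, m ≤ (A i).card) :
    ((D.choose z : ℤ) + ∑ k ∈ Finset.Icc 1 B, (-1 : ℤ) ^ k * (B.choose k : ℤ) *
        (((D - k * m).choose z : ℤ))) ≤
      ((((Finset.univ : Finset U).powersetCard z).filter
          fun S => ∀ i, (S ∩ A i).Nonempty).card : ℤ) := by
  choose A' hsub hA' using fun i => Finset.exists_subset_card_eq (hcard i)
  have h := card_powersetCard_filter_inter_nonempty z m A'
    (fun i j hij => (hdisj hij).mono (hsub i) (hsub j)) hA'
  rw [Fintype.card_fin, hD, Finset.range_eq_Ico, Finset.sum_eq_sum_Ico_succ_bot (by omega)] at h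
  simp only [pow_zero, Nat.choose_zero_right, Nat.cast_one, one_mul, zero_mul, Nat.sub_zero,
    zero_add] at h
  refine h.symm.trans_le (Nat.cast_le.2 (Finset.card_le_card fun S hS => ?_))
  simp only [Finset.mem_filter] at hS ⊢
  exact ⟨hS.1, fun i => (hS.2 i).mono (Finset.inter_subset_inter_left (hsub i))⟩
end

section
/- Let n, K ∈ ℕ, let C₁, …, C_K ⊆ ℝⁿ be convex sets, and let c : ℝⁿ → ℝ be a linear functional. Suppose x* is the unique minimizer of c over the intersection ⋂_{k=1}^{K} C_k (i.e., x* lies in the intersection, c(x*) ≤ c(y) for all y in the intersection, and any y in the intersection with c(y) = c(x*) equals x*). Call an index k a support index if there exists y ∈ ⋂_{j ≠ k} C_j with c(y) < c(x*). Then the number of support indices is at most n. -/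
/-- Proposition 3.7 (Calafiore–Campi bound on support constraints): for a linear objective
minimized over an intersection of `K` convex sets in `ℝⁿ` with unique minimizer `x*`, the
number of support indices — indices whose removal strictly improves the optimum — is at
most `n`. -/
theorem card_support_indices_le_dim (n K : ℕ) (C : Fin K → Set (Fin n → ℝ))
    (hconv : ∀ k, Convex ℝ (C k)) (c : (Fin n → ℝ) →ₗ[ℝ] ℝ)
    (xstar : Fin n → ℝ)
    (hmem : xstar ∈ ⋂ k, C k)
    (hopt : ∀ y ∈ ⋂ k, C k, c xstar ≤ c y)
    (huniq : ∀ y ∈ ⋂ k, C k, c y = c xstar → y = xstar) :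
    {k : Fin K | ∃ y, (∀ j, j ≠ k → y ∈ C j) ∧ c y < c xstar}.ncard ≤ n := by
  classical
  by_contra! hcard
  let F : Option (Fin K) → Set (Fin n → ℝ) := fun o => o.elim {y | c y < c xstar} C
  have hF : (⋂ i ∈ (Finset.univ : Finset (Option (Fin K))), F i).Nonempty := by
    refine Convex.helly_theorem' (𝕜 := ℝ) ?_ ?_
    · rintro (_ | k) -
      · exact convex_halfSpace_lt c.isLinear _
      · exact hconv k
    · intro I _ hI
      rw [Module.finrank_fin_fun] at hI
      by_cases hnone : none ∈ I
      · have hle : I.eraseNone.card ≤ n := by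
          rw [Finset.card_eraseNone_of_mem hnone]
          omega
        obtain ⟨k, ⟨y, hy, hyc⟩, hk⟩ := Set.exists_mem_notMem_of_ncard_lt_ncard
          (((Set.ncard_coe_finset I.eraseNone).trans_le hle).trans_lt hcard)
        refine ⟨y, Set.mem_iInter₂.2 ?_⟩
        rintro (_ | j) hj
        · exact hyc
        · refine hy j ?_
          rintro rfl
          exact hk (by simpa using hj)
      · refine ⟨xstar, Set.mem_iInter₂.2 ?_⟩
        rintro (_ | j) hj
        · exact absurd hj hnone
        · exact Set.mem_iInter.1 hmem j
  obtain ⟨y, hy⟩ := hF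
  rw [Set.mem_iInter₂] at hy
  exact (hopt y (Set.mem_iInter.2 fun k => hy (some k) (Finset.mem_univ _))).not_gt
    (hy none (Finset.mem_univ _))
end
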